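/- Let S ⊆ ℝⁿ (n ≥ 2) be a centrally symmetric convex body of class C²₊ (C² boundary with everywhere strictly positive Gauss curvature). Then there is a nonnegative function φ with φ(Δ) → 0 as Δ → 0 such that for every x ∈ ∂S and every sufficiently small Δ > 0, ((2Δ)^{(n+1)/2}/(n+1))·(|B₂^{n−1}|_{n−1}/κ(x)^{1/2})·(1 − φ(Δ)) ≤ |{ξ ∈ S : ⟨ξ − x, u(x)⟩ ≥ −Δ}|ₙ ≤ ((2Δ)^{(n+1)/2}/(n+1))·(|B₂^{n−1}|_{n−1}/κ(x)^{1/2})·(1 + φ(Δ)). -/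

import Mathlib

open MeasureTheory Metric Set Filter
open scoped RealInnerProductSpace Pointwise Topology

noncomputable section

abbrev Euc (n : ℕ) : Type := EuclideanSpace ℝ (Fin n)

/-- A centrally symmetric convex body in `ℝⁿ`. -/
def IsSymConvexBody {n : ℕ} (S : Set (Euc n)) : Prop :=
  IsCompact S ∧ Convex ℝ S ∧ (interior S).Nonempty ∧ S = -S

/-- The convex floating body `K_δ`: the intersection of all closed halfspaces whose bounding
hyperplane cuts off a set of volume at most `δ·|K|ₙ` from `K`. -/
def floatingBody {n : ℕ} (K : Set (Euc n)) (δ : ℝ) : Set (Euc n) :=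
  ⋂ (v : Euc n) (_ : v ≠ 0) (c : ℝ)
    (_ : volume (K ∩ {y | c ≤ ⟪v, y⟫}) ≤ ENNReal.ofReal δ * volume K),
    {y | ⟪v, y⟫ ≤ c}

/-- The illumination body `K^δ`. -/
def illuminationBody {n : ℕ} (K : Set (Euc n)) (δ : ℝ) : Set (Euc n) :=
  {x | volume (convexHull ℝ (K ∪ {x})) ≤ ENNReal.ofReal (1 + δ) * volume K}

/-- The polar body `K°`. -/
def polarBody {n : ℕ} (K : Set (Euc n)) : Set (Euc n) :=
  {y | ∀ x ∈ K, ⟪x, y⟫ ≤ 1}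

/-- The distance `d(C₁, C₂) = inf {a ≥ 1 : a⁻¹ C₁ ⊆ C₂ ⊆ a C₁}`. -/
def bodyDist {n : ℕ} (C₁ C₂ : Set (Euc n)) : ℝ :=
  sInf {a : ℝ | 1 ≤ a ∧ a⁻¹ • C₁ ⊆ C₂ ∧ C₂ ⊆ a • C₁}

/-- `d_C(δ) = inf_{δ' > 0} d(C_δ, ((C°)^{δ'})°)`. -/
def dualDist {n : ℕ} (C : Set (Euc n)) (δ : ℝ) : ℝ :=
  sInf {r : ℝ | ∃ δ' > (0:ℝ), r = bodyDist (floatingBody C δ)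
      (polarBody (illuminationBody (polarBody C) δ'))}

/-- `ν` is an outer unit normal of `S` at `x`. -/
def IsOuterNormalAt {n : ℕ} (S : Set (Euc n)) (x ν : Euc n) : Prop :=
  ‖ν‖ = 1 ∧ ∀ y ∈ S, ⟪y, ν⟫ ≤ ⟪x, ν⟫

/-- Near `x ∈ ∂S`, the boundary of `S` is the graph of a `C²` function `f` over the tangent
hyperplane at `x` (embedded via a linear isometry `L` orthogonal to the normal `ν`), with
`f 0 = 0` and vanishing derivative at `0`, and `k` is the determinant of the Hessian of `f`
at `0`, i.e. the Gauss curvature of `∂S` at `x`. -/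
def IsGaussCurvatureAt {n : ℕ} (S : Set (Euc n)) (x ν : Euc n) (k : ℝ) : Prop :=
  ∃ (L : Euc (n-1) →ₗᵢ[ℝ] Euc n) (f : Euc (n-1) → ℝ) (τ ε : ℝ),
    0 < τ ∧ 0 < ε ∧
    (∀ v, ⟪L v, ν⟫ = 0) ∧
    ContDiffOn ℝ 2 f (ball 0 τ) ∧
    f 0 = 0 ∧ fderiv ℝ f 0 = 0 ∧
    frontier S ∩ ball x ε
      = {y | ∃ v ∈ ball (0 : Euc (n-1)) τ, y = x + L v - f v • ν} ∩ ball x ε ∧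
    k = (Matrix.of fun i j : Fin (n-1) =>
      iteratedFDeriv ℝ 2 f 0 ![EuclideanSpace.single i 1, EuclideanSpace.single j 1]).det

/-- `S` has `C²` boundary, with outer unit normal map `u` and Gauss curvature function `κ`. -/
def IsC2Body {n : ℕ} (S : Set (Euc n)) (u : Euc n → Euc n) (κ : Euc n → ℝ) : Prop :=
  ∀ x ∈ frontier S, IsOuterNormalAt S x (u x) ∧ IsGaussCurvatureAt S x (u x) (κ x)

/-- The constant `c(K, n) = ((n+1)^{2/(n+1)}/2)·(|K|ₙ/|B₂^{n−1}|_{n−1})^{2/(n+1)}`. -/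
def cConst (n : ℕ) (K : Set (Euc n)) : ℝ :=
  ((n + 1 : ℝ) ^ ((2:ℝ)/(n+1)) / 2) *
    ((volume K).toReal / (volume (ball (0 : Euc (n-1)) 1)).toReal) ^ ((2:ℝ)/(n+1))

/-- The function `G_S(x) = c(S,n)·κ(x)^{1/(n+1)} / ⟨x, u(x)⟩`. -/
def Gfun {n : ℕ} (S : Set (Euc n)) (u : Euc n → Euc n) (κ : Euc n → ℝ) (x : Euc n) : ℝ :=
  cConst n S * (κ x) ^ ((1:ℝ)/(n+1)) / ⟪x, u x⟫


/-- A linear isometry onto a hyperplane together with a unit normal is an orthonormal frame. -/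
def frameEquiv {n d : ℕ} (hnd : n = d + 1) (L : Euc d →ₗᵢ[ℝ] Euc n) (ν : Euc n)
    (hν : ‖ν‖ = 1) (hL : ∀ v, ⟪L v, ν⟫ = 0) : WithLp 2 (Euc d × ℝ) ≃ₗᵢ[ℝ] Euc n :=
  LinearIsometry.toLinearIsometryEquiv
    { toFun := fun p => L p.fst - p.snd • ν
      map_add' := fun p q => by
        simp only [WithLp.add_fst, WithLp.add_snd, map_add, add_smul]; abel
      map_smul' := fun c p => by
        simp [smul_sub, mul_smul]
      norm_map' := fun p => by
        have h : ‖L p.fst - p.snd • ν‖ ^ 2 = ‖p‖ ^ 2 := by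
          rw [norm_sub_sq_real, WithLp.prod_norm_sq_eq_of_L2, L.norm_map, inner_smul_right, hL,
            norm_smul, hν]
          simp
        exact (sq_eq_sq₀ (norm_nonneg _) (norm_nonneg _)).1 h }
    (by
      rw [(WithLp.linearEquiv 2 ℝ (Euc d × ℝ)).finrank_eq]
      simp [hnd])

theorem frameEquiv_apply {n d : ℕ} (hnd : n = d + 1) (L : Euc d →ₗᵢ[ℝ] Euc n) (ν : Euc n)
    (hν : ‖ν‖ = 1) (hL : ∀ v, ⟪L v, ν⟫ = 0) (p : WithLp 2 (Euc d × ℝ)) :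
    frameEquiv hnd L ν hν hL p = L p.fst - p.snd • ν := rfl

theorem exists_frame_coords {n d : ℕ} (hnd : n = d + 1) (L : Euc d →ₗᵢ[ℝ] Euc n) (ν : Euc n)
    (hν : ‖ν‖ = 1) (hL : ∀ v, ⟪L v, ν⟫ = 0) (y : Euc n) :
    ∃ (a : Euc d) (b : ℝ), y = L a - b • ν := by
  obtain ⟨p, hp⟩ := (frameEquiv hnd L ν hν hL).surjective y
  exact ⟨p.fst, p.snd, by rw [← hp, frameEquiv_apply]⟩

theorem measurePreserving_frame {n d : ℕ} (hnd : n = d + 1) (L : Euc d →ₗᵢ[ℝ] Euc n) (ν : Euc n)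
    (hν : ‖ν‖ = 1) (hL : ∀ v, ⟪L v, ν⟫ = 0) (x : Euc n) (l : Euc d →L[ℝ] ℝ) :
    MeasurePreserving (fun p : Euc d × ℝ => x + (L p.1 - (l p.1 + p.2) • ν)) volume volume := by
  have h1 : MeasurePreserving (fun p : Euc d × ℝ => (p.1, l p.1 + p.2)) volume volume :=
    MeasurePreserving.skew_product (g := fun a b => l a + b) (MeasurePreserving.id volume)
      (by simp only [Function.uncurry_def]; fun_prop)
      (ae_of_all _ fun a => (measurePreserving_add_left volume (l a)).map_eq)
  have h2 := WithLp.volume_preserving_toLp (Euc d) ℝ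
  have h3 := (frameEquiv hnd L ν hν hL).measurePreserving
  exact (measurePreserving_add_left volume x).comp (h3.comp (h2.comp h1))

theorem volume_norm_map_sq_le {d : ℕ} (R : Euc d →ₗ[ℝ] Euc d)
    (hR : LinearMap.det R ≠ 0) {r : ℝ} (hr : 0 ≤ r) :
    volume {h : Euc d | ‖R h‖ ^ 2 ≤ r} = ENNReal.ofReal
      (r ^ ((d : ℝ) / 2) * ((volume (ball (0 : Euc d) 1)).toReal / |LinearMap.det R|)) := by
  have : {h : Euc d | ‖R h‖ ^ 2 ≤ r} = R ⁻¹' closedBall 0 (√r) := by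
    ext h; simp [Real.le_sqrt (norm_nonneg _) hr]
  rw [this, Measure.addHaar_preimage_linearMap _ hR, Measure.addHaar_closedBall _ _ (by positivity),
    ← ENNReal.ofReal_toReal (a := volume (ball (0 : Euc d) 1)) measure_ball_lt_top.ne,
    ← ENNReal.ofReal_mul (by positivity), ← ENNReal.ofReal_mul (by positivity),
    ENNReal.toReal_ofReal (by positivity)]
  have h2 : r ^ ((d : ℝ) / 2) = √r ^ d := by
    rw [Real.sqrt_eq_rpow, ← Real.rpow_natCast, ← Real.rpow_mul hr]; congr 1; ring
  rw [h2]
  simp only [finrank_euclideanSpace, Fintype.card_fin, abs_inv]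
  congr 1
  field_simp

/-- The volume of a truncated elliptic paraboloid. -/
theorem volume_paraboloid {d : ℕ} (hd : 1 ≤ d) (R : Euc d →ₗ[ℝ] Euc d)
    (hR : LinearMap.det R ≠ 0) {a Δ : ℝ} (ha : 0 < a) (hΔ : 0 ≤ Δ) :
    volume {p : Euc d × ℝ | a * ‖R p.1‖ ^ 2 ≤ 2 * p.2 ∧ p.2 ≤ Δ} = ENNReal.ofReal
      (a ^ (-((d : ℝ) / 2)) * Δ ^ ((d : ℝ) / 2 + 1) * (2 ^ ((d : ℝ) / 2) / ((d : ℝ) / 2 + 1) *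
        ((volume (ball (0 : Euc d) 1)).toReal / |LinearMap.det R|))) := by
  have hRc : Continuous R := R.continuous_of_finiteDimensional
  have hm : MeasurableSet {p : Euc d × ℝ | a * ‖R p.1‖ ^ 2 ≤ 2 * p.2 ∧ p.2 ≤ Δ} := by
    apply IsClosed.measurableSet
    have h1 : Continuous fun p : Euc d × ℝ => a * ‖R p.1‖ ^ 2 := by fun_prop
    have h2 : Continuous fun p : Euc d × ℝ => 2 * p.2 := by fun_prop
    exact (isClosed_le h1 h2).inter (isClosed_le continuous_snd continuous_const)
  set V := (volume (ball (0 : Euc d) 1)).toReal / |LinearMap.det R| with hV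
  have hV0 : 0 ≤ V := by positivity
  have hd0 : (0 : ℝ) < d := by exact_mod_cast hd
  have hslice : ∀ t : ℝ, volume ((fun h : Euc d => (h, t)) ⁻¹'
      {p : Euc d × ℝ | a * ‖R p.1‖ ^ 2 ≤ 2 * p.2 ∧ p.2 ≤ Δ}) =
      (Icc 0 Δ).indicator (fun t => ENNReal.ofReal ((2 * t / a) ^ ((d : ℝ) / 2) * V)) t := by
    intro t
    by_cases ht : t ∈ Icc 0 Δ
    · rw [indicator_of_mem ht, hV,
        ← volume_norm_map_sq_le R hR (div_nonneg (mul_nonneg zero_le_two ht.1) ha.le)]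
      congr 1
      ext h
      simp [ht.2, le_div_iff₀' ha]
    · rw [indicator_of_notMem ht]
      convert measure_empty (μ := (volume : Measure (Euc d)))
      ext h
      simp only [mem_preimage, mem_ofPred_eq, mem_empty_iff_false, iff_false]
      rintro ⟨h1, h2⟩
      refine ht ⟨?_, h2⟩
      have : 0 ≤ a * ‖R h‖ ^ 2 := by positivity
      linarith
  rw [Measure.volume_eq_prod, Measure.prod_apply_symm hm]
  simp_rw [hslice]
  rw [lintegral_indicator measurableSet_Icc]
  have hcont : Continuous fun t : ℝ => (2 * t / a) ^ ((d : ℝ) / 2) * V :=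
    ((by fun_prop : Continuous fun t : ℝ => 2 * t / a).rpow_const
      fun _ => Or.inr (by positivity)).mul continuous_const
  rw [← ofReal_integral_eq_lintegral_ofReal hcont.integrableOn_Icc
    ((ae_restrict_iff' measurableSet_Icc).2 (ae_of_all _ fun t ht =>
      mul_nonneg (Real.rpow_nonneg (div_nonneg (mul_nonneg zero_le_two ht.1) ha.le) _) hV0))]
  congr 1
  rw [integral_Icc_eq_integral_Ioc, ← intervalIntegral.integral_of_le hΔ]
  have : ∀ t ∈ uIcc 0 Δ, (2 * t / a) ^ ((d : ℝ) / 2) * V =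
      (2 ^ ((d : ℝ) / 2) * a ^ (-((d : ℝ) / 2)) * V) * t ^ ((d : ℝ) / 2) := by
    intro t ht
    rw [uIcc_of_le hΔ] at ht
    rw [Real.div_rpow (by linarith [ht.1]) ha.le, Real.mul_rpow zero_le_two ht.1,
      Real.rpow_neg ha.le]
    ring
  rw [intervalIntegral.integral_congr this, intervalIntegral.integral_const_mul,
    integral_rpow (Or.inl (by linarith)), Real.zero_rpow (by positivity)]
  ring

open scoped MatrixOrder Matrix.Norms.L2Operator in
theorem exists_linearMap_norm_sq_eq {d : ℕ} (B : Euc d →L[ℝ] Euc d →L[ℝ] ℝ)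
    (hsymm : ∀ x y, B x y = B y x) (hnonneg : ∀ x, 0 ≤ B x x) :
    ∃ R : Euc d →ₗ[ℝ] Euc d, (∀ h, ‖R h‖ ^ 2 = B h h) ∧
      |LinearMap.det R| = √(Matrix.of fun i j : Fin d =>
        B (EuclideanSpace.single i 1) (EuclideanSpace.single j 1)).det := by
  set H : Matrix (Fin d) (Fin d) ℝ := Matrix.of fun i j : Fin d =>
      B (EuclideanSpace.single i 1) (EuclideanSpace.single j 1) with hH
  have hB : ∀ x : Euc d, B x x = x.ofLp ⬝ᵥ (H.mulVec x.ofLp) := by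
    intro x
    have hx : x = ∑ i, x i • EuclideanSpace.single i (1 : ℝ) := by
      conv_lhs => rw [← (EuclideanSpace.basisFun (Fin d) ℝ).sum_repr x]
      simp
    conv_lhs => rw [hx]
    simp only [map_sum, map_smul, _root_.sum_apply, _root_.smul_apply,
      smul_eq_mul, dotProduct, Matrix.mulVec, hH, Matrix.of_apply, Finset.mul_sum]
    refine (Finset.sum_comm).trans
      (Finset.sum_congr rfl fun i _ => Finset.sum_congr rfl fun j _ => ?_)
    ring
  have hpsd : H.PosSemidef := by
    refine Matrix.PosSemidef.of_dotProduct_mulVec_nonneg ?_ fun x => ?_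
    · ext i j
      simp [hH, hsymm]
    · have := hnonneg (WithLp.toLp 2 x)
      rw [hB] at this
      simpa using this
  obtain ⟨M, hM⟩ := CStarAlgebra.nonneg_iff_eq_star_mul_self.mp hpsd.nonneg
  rw [Matrix.star_eq_conjTranspose] at hM
  refine ⟨Matrix.toEuclideanLin M, fun h => ?_, ?_⟩
  · rw [hB, hM, EuclideanSpace.real_norm_sq_eq, ← Matrix.mulVec_mulVec,
      Matrix.dotProduct_mulVec]
    simp [Matrix.vecMul_transpose, dotProduct, sq]
  · rw [hM, Matrix.det_mul, Matrix.det_conjTranspose, star_trivial, Real.sqrt_mul_self_eq_abs]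
    congr 1
    rw [Matrix.toEuclideanLin_eq_toLin_orthonormal, LinearMap.det_toLin]

/-- A function that is `C²` at `0` has a second order expansion there, uniformly in the base
point. -/
theorem eventually_abs_taylor_le {d : ℕ} {f : Euc d → ℝ} (hf : ContDiffAt ℝ 2 f 0) {c : ℝ}
    (hc : 0 < c) :
    ∃ ρ > 0, ∀ v ∈ ball (0 : Euc d) ρ, ∀ w ∈ ball (0 : Euc d) ρ,
      |f w - f v - fderiv ℝ f v (w - v) - fderiv ℝ (fderiv ℝ f) 0 (w - v) (w - v) / 2|
        ≤ c * ‖w - v‖ ^ 2 := by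
  set B := fderiv ℝ (fderiv ℝ f) 0 with hB
  have hsymm : ∀ x y, B x y = B y x := hf.isSymmSndFDerivAt (by simp)
  have hstrict : HasStrictFDerivAt (fderiv ℝ f) B 0 :=
    (hf.fderiv_right (m := 1) (by norm_num)).hasStrictFDerivAt (by norm_num)
  have hdiff : ∀ᶠ x in 𝓝 (0 : Euc d), DifferentiableAt ℝ f x := by
    filter_upwards [hf.eventually (by simp)] with x hx
    exact hx.differentiableAt (by norm_num)
  have hest := (hstrict.isLittleO.def hc)
  obtain ⟨ρ₁, hρ₁, h₁⟩ := Metric.eventually_nhds_iff_ball.1 hdiff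
  obtain ⟨ρ₂, hρ₂, h₂⟩ := Metric.eventually_nhds_iff_ball.1 hest
  refine ⟨min ρ₁ ρ₂, lt_min hρ₁ hρ₂, fun v hv w hw => ?_⟩
  have hv1 := ball_subset_ball (min_le_left _ _) hv
  have hw1 := ball_subset_ball (min_le_left _ _) hw
  have hv2 := ball_subset_ball (min_le_right _ _) hv
  have hw2 := ball_subset_ball (min_le_right _ _) hw
  have key := (convex_segment v w).norm_image_sub_le_of_norm_hasFDerivWithin_le (𝕜 := ℝ)
    (f := fun z => f z - f v - fderiv ℝ f v (z - v) - B (z - v) (z - v) / 2)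
    (f' := fun z => fderiv ℝ f z - fderiv ℝ f v - B (z - v)) (C := c * ‖w - v‖)
    (x := v) (y := w) (fun z hz => ?_) (fun z hz => ?_) (left_mem_segment ℝ v w)
    (right_mem_segment ℝ v w)
  · simp only [sub_self, map_zero, sub_zero, zero_div, Real.norm_eq_abs] at key
    linarith [key, (by ring : c * ‖w - v‖ * ‖w - v‖ = c * ‖w - v‖ ^ 2)]
  · have hz1 : z ∈ ball (0 : Euc d) ρ₁ := (convex_ball _ _).segment_subset hv1 hw1 hz
    have hsub : HasFDerivAt (fun z : Euc d => z - v) (ContinuousLinearMap.id ℝ (Euc d)) z :=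
      (hasFDerivAt_id z).sub_const v
    have hlin : HasFDerivAt (fun z => fderiv ℝ f v (z - v)) (fderiv ℝ f v) z := by
      have h := (fderiv ℝ f v).hasFDerivAt.comp z hsub
      rwa [ContinuousLinearMap.comp_id] at h
    have hBz : HasFDerivAt (fun z => B (z - v)) B z := by
      have h := B.hasFDerivAt.comp z hsub
      rwa [ContinuousLinearMap.comp_id] at h
    have hq := (hBz.clm_apply hsub).mul_const (2 : ℝ)⁻¹
    have := ((((h₁ z hz1).hasFDerivAt.sub_const (f v)).sub hlin).sub hq).hasFDerivWithinAt
      (s := segment ℝ v w)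
    simp only [← div_eq_mul_inv] at this
    refine this.congr_fderiv ?_
    ext h
    simp [hsymm h]
    ring
  · have hz2 : z ∈ ball (0 : Euc d) ρ₂ := (convex_ball _ _).segment_subset hv2 hw2 hz
    refine (h₂ (z, v) (by rw [← ball_prod_same]; exact ⟨hz2, hv2⟩)).trans ?_
    gcongr
    obtain ⟨θ, ⟨hθ0, hθ1⟩, rfl⟩ := (segment_eq_image' ℝ v w) ▸ hz
    simp only [add_sub_cancel_left, norm_smul, Real.norm_eq_abs, abs_of_nonneg hθ0]
    exact mul_le_of_le_one_left (norm_nonneg _) hθ1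

/-- The point with coordinates `a` along the hyperplane and height `b` below it, in the frame
based at `x` with inward direction `-ν`. -/
def chartPt {n d : ℕ} (L : Euc d →ₗᵢ[ℝ] Euc n) (x ν : Euc n) (a : Euc d) (b : ℝ) : Euc n :=
  x + L a - b • ν

theorem inner_lt_of_mem_interior {n : ℕ} {S : Set (Euc n)} {q ν z : Euc n}
    (h : IsOuterNormalAt S q ν) (hz : z ∈ interior S) : ⟪z, ν⟫ < ⟪q, ν⟫ := by
  have hcont : Tendsto (fun δ : ℝ => z + δ • ν) (𝓝[>] 0) (𝓝 z) := by
    have : Continuous fun δ : ℝ => z + δ • ν := by fun_prop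
    have h := this.tendsto 0
    simp only [zero_smul, add_zero] at h
    exact h.mono_left nhdsWithin_le_nhds
  obtain ⟨δ, hδS, hδ⟩ := ((hcont.eventually (mem_interior_iff_mem_nhds.1 hz)).and
    self_mem_nhdsWithin).exists
  have h2 := h.2 _ hδS
  rw [inner_add_left, inner_smul_left, real_inner_self_eq_norm_sq, h.1] at h2
  simp only [conj_trivial] at h2
  have : (0 : ℝ) < δ := hδ
  linarith

section Chart

variable {n d : ℕ} {L : Euc d →ₗᵢ[ℝ] Euc n} {x ν : Euc n}

theorem chartPt_sub (a a' : Euc d) (b b' : ℝ) :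
    chartPt L x ν a b - chartPt L x ν a' b' = L (a - a') - (b - b') • ν := by
  simp only [chartPt, map_sub, sub_smul]; abel

theorem norm_frame_sq (hν : ‖ν‖ = 1) (hL : ∀ v, ⟪L v, ν⟫ = 0) (a : Euc d) (b : ℝ) :
    ‖L a - b • ν‖ ^ 2 = ‖a‖ ^ 2 + b ^ 2 := by
  rw [norm_sub_sq_real, L.norm_map, inner_smul_right, hL, norm_smul, hν]
  simp

theorem norm_le_norm_chartPt_sub (hν : ‖ν‖ = 1) (hL : ∀ v, ⟪L v, ν⟫ = 0) (a : Euc d) (b : ℝ) :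
    ‖a‖ ≤ ‖chartPt L x ν a b - x‖ := by
  have h : chartPt L x ν a b - x = L a - b • ν := by simp only [chartPt]; abel
  rw [h, ← sq_le_sq₀ (norm_nonneg _) (norm_nonneg _), norm_frame_sq hν hL]
  nlinarith [sq_nonneg b]

/-- At a graph point of the boundary the outer normal is proportional to `ν + L ∇f`. -/
theorem inner_normal_of_graph (hnd : n = d + 1) (hν : ‖ν‖ = 1) (hL : ∀ v, ⟪L v, ν⟫ = 0)
    {S : Set (Euc n)} {f : Euc d → ℝ} {w : Euc d} {u' : Euc n} {l : Euc d →L[ℝ] ℝ}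
    (hf : HasFDerivAt f l w) (hgraph : ∀ᶠ w' in 𝓝 w, chartPt L x ν w' (f w') ∈ S)
    (hu : IsOuterNormalAt S (chartPt L x ν w (f w)) u') :
    ⟪ν, u'⟫ ≠ 0 ∧ ⟪ν, u'⟫ ≤ 1 ∧ 1 ≤ ⟪ν, u'⟫ ^ 2 * (1 + ‖l‖ ^ 2) ∧
      ∀ a b, ⟪chartPt L x ν a b - chartPt L x ν w (f w), u'⟫
        = ⟪ν, u'⟫ * (l (a - w) - (b - f w)) := by
  set c := ⟪ν, u'⟫ with hc
  have hder : ∀ h, ⟪L h, u'⟫ = c * l h := by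
    have hmax : IsLocalMax (fun w' => ⟪u', L w'⟫ - f w' * c) w := by
      filter_upwards [hgraph] with w' hw'
      have h := hu.2 _ hw'
      have h2 : ⟪chartPt L x ν w' (f w') - chartPt L x ν w (f w), u'⟫ ≤ 0 := by
        rw [inner_sub_left]; linarith
      rw [chartPt_sub, inner_sub_left, inner_smul_left, map_sub, inner_sub_left] at h2
      simp only [conj_trivial, ← hc] at h2
      rw [real_inner_comm (L w') u', real_inner_comm (L w) u']
      linarith
    have hd : HasFDerivAt (fun w' => ⟪u', L w'⟫ - f w' * c)
        ((innerSL ℝ u').comp L.toContinuousLinearMap - c • l) w :=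
      ((innerSL ℝ u').comp L.toContinuousLinearMap).hasFDerivAt.sub (hf.mul_const c)
    have h0 := hmax.hasFDerivAt_eq_zero hd
    intro h
    have h1 := DFunLike.congr_fun h0 h
    simp at h1
    rw [real_inner_comm]
    linarith
  obtain ⟨g, t, hgt⟩ := exists_frame_coords hnd L ν hν hL u'
  have hct : c = -t := by
    rw [hc, hgt, inner_sub_right, real_inner_comm, hL, inner_smul_right, real_inner_self_eq_norm_sq,
      hν]
    ring
  have hnorm : ‖g‖ ^ 2 + c ^ 2 = 1 := by
    have h := norm_frame_sq (L := L) hν hL g t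
    rw [← hgt, hu.1] at h
    rw [hct]; linarith
  have hg : ‖g‖ ^ 2 = c * l g := by
    rw [← hder g, hgt, inner_sub_right, inner_smul_right, hL, real_inner_self_eq_norm_sq,
      L.norm_map]
    ring
  have hg2 : ‖g‖ ≤ |c| * ‖l‖ := by
    have h1 : ‖g‖ ^ 2 ≤ |c| * ‖l‖ * ‖g‖ := by
      rw [hg]
      calc c * l g ≤ |c| * |l g| := by rw [← abs_mul]; exact le_abs_self _
        _ ≤ |c| * (‖l‖ * ‖g‖) := by gcongr; exact l.le_opNorm g
        _ = _ := by ring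
    rcases (norm_nonneg g).eq_or_lt with h0 | h0
    · rw [← h0]; positivity
    · rw [sq] at h1; exact le_of_mul_le_mul_right h1 h0
  have hone : 1 ≤ c ^ 2 * (1 + ‖l‖ ^ 2) := by
    have : ‖g‖ ^ 2 ≤ (|c| * ‖l‖) ^ 2 := by gcongr
    rw [mul_pow, sq_abs] at this
    linarith
  refine ⟨fun h0 => ?_, ?_, hone, fun a b => ?_⟩
  · rw [h0] at hone; norm_num at hone
  · nlinarith [sq_nonneg ‖g‖]
  · rw [chartPt_sub, inner_sub_left, inner_smul_left, hder]
    simp only [conj_trivial, ← hc]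
    ring

/-- Local structure of a convex body near a boundary point at which the boundary is a graph. -/
theorem exists_graph_radius (hnd : n = d + 1) (hν : ‖ν‖ = 1) (hL : ∀ v, ⟪L v, ν⟫ = 0)
    {S : Set (Euc n)} (hclosed : IsClosed S) (hconv : Convex ℝ S) (hint : (interior S).Nonempty)
    {u : Euc n → Euc n} (hu : ∀ y ∈ frontier S, IsOuterNormalAt S y (u y))
    (hx : x ∈ frontier S) (hux : u x = ν)
    {f : Euc d → ℝ} {τ ε : ℝ} (hτ : 0 < τ) (hε : 0 < ε) (hf : ContDiffOn ℝ 2 f (ball 0 τ))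
    (hf0 : f 0 = 0) (hf'0 : fderiv ℝ f 0 = 0)
    (hgraph : frontier S ∩ ball x ε
      = {y | ∃ v ∈ ball (0 : Euc d) τ, y = x + L v - f v • ν} ∩ ball x ε) :
    ∃ r > 0, r ≤ τ ∧ (∀ w ∈ ball (0 : Euc d) r, chartPt L x ν w (f w) ∈ frontier S) ∧
      (∀ w ∈ ball (0 : Euc d) r, ∃ c > 0, c ≤ 1 ∧ 1 ≤ c ^ 2 * (1 + ‖fderiv ℝ f w‖ ^ 2) ∧
        ∀ a b, ⟪chartPt L x ν a b - chartPt L x ν w (f w), u (chartPt L x ν w (f w))⟫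
          = c * (fderiv ℝ f w (a - w) - (b - f w))) ∧
      (∀ y ∈ frontier S ∩ ball x r, ∃ w ∈ ball (0 : Euc d) r, y = chartPt L x ν w (f w)) ∧
      (∀ a b, chartPt L x ν a b ∈ ball x r → f a ≤ b → chartPt L x ν a b ∈ S) := by
  obtain ⟨z, hz⟩ := hint
  obtain ⟨a₀, b₀, hab⟩ := exists_frame_coords hnd L ν hν hL (z - x)
  have hzc : z = chartPt L x ν a₀ b₀ := by
    rw [chartPt, add_sub_assoc, ← hab]; abel
  have hfront : frontier S ⊆ S := hclosed.frontier_subset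
  have hb₀ : 0 < b₀ := by
    have h := inner_lt_of_mem_interior (hux ▸ hu x hx) hz
    have h2 : ⟪z - x, ν⟫ < 0 := by rw [inner_sub_left]; linarith
    rw [hab, inner_sub_left, hL, inner_smul_left, real_inner_self_eq_norm_sq, hν] at h2
    simp only [conj_trivial] at h2
    linarith
  have hf1 : ∀ w ∈ ball (0 : Euc d) τ, ContDiffAt ℝ 2 f w := fun w hw =>
    hf.contDiffAt (isOpen_ball.mem_nhds hw)
  have h0τ : (0 : Euc d) ∈ ball 0 τ := mem_ball_self hτ
  have hfc : ContinuousAt f 0 := (hf1 0 h0τ).continuousAt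
  have hf'c : ContinuousAt (fderiv ℝ f) 0 :=
    ((hf1 0 h0τ).fderiv_right (m := 1) (by norm_num)).continuousAt
  have hx0 : chartPt L x ν 0 0 = x := by simp [chartPt]
  have e1 : ∀ᶠ w in 𝓝 (0 : Euc d), chartPt L x ν w (f w) ∈ ball x ε := by
    have : ContinuousAt (fun w => chartPt L x ν w (f w)) 0 := by
      unfold chartPt
      fun_prop
    apply this.eventually_mem
    simp only [hf0, hx0]
    exact ball_mem_nhds x hε
  have e2 : ∀ᶠ w in 𝓝 (0 : Euc d), fderiv ℝ f w (a₀ - w) - (b₀ - f w) < 0 := by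
    have : ContinuousAt (fun w => fderiv ℝ f w (a₀ - w) - (b₀ - f w)) 0 :=
      (hf'c.clm_apply (by fun_prop)).sub (by fun_prop)
    refine this.eventually_lt continuousAt_const ?_
    simpa [hf'0, hf0] using hb₀
  obtain ⟨r₁, hr₁, h₁⟩ := Metric.eventually_nhds_iff_ball.1 (e1.and e2)
  refine ⟨min r₁ (min τ ε), by positivity, by simp, ?_⟩
  set r := min r₁ (min τ ε) with hr
  have hr₁' : ball (0 : Euc d) r ⊆ ball 0 r₁ := ball_subset_ball (min_le_left _ _)
  have hrτ : ball (0 : Euc d) r ⊆ ball 0 τ :=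
    ball_subset_ball ((min_le_right _ _).trans (min_le_left _ _))
  have hrε : ball x r ⊆ ball x ε :=
    ball_subset_ball ((min_le_right _ _).trans (min_le_right _ _))
  have hA : ∀ w ∈ ball (0 : Euc d) r, chartPt L x ν w (f w) ∈ frontier S := by
    intro w hw
    have : chartPt L x ν w (f w) ∈ frontier S ∩ ball x ε := by
      rw [hgraph]
      exact ⟨⟨w, hrτ hw, rfl⟩, (h₁ w (hr₁' hw)).1⟩
    exact this.1
  have hB : ∀ w ∈ ball (0 : Euc d) r, ∃ c > 0, c ≤ 1 ∧ 1 ≤ c ^ 2 * (1 + ‖fderiv ℝ f w‖ ^ 2) ∧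
        ∀ a b, ⟪chartPt L x ν a b - chartPt L x ν w (f w), u (chartPt L x ν w (f w))⟫
          = c * (fderiv ℝ f w (a - w) - (b - f w)) := by
    intro w hw
    have hnear : ∀ᶠ w' in 𝓝 w, chartPt L x ν w' (f w') ∈ S := by
      filter_upwards [isOpen_ball.mem_nhds hw] with w' hw' using hfront (hA w' hw')
    obtain ⟨h1, h2, h3, h4⟩ := inner_normal_of_graph hnd hν hL
      ((hf1 w (hrτ hw)).differentiableAt (by norm_num)).hasFDerivAt hnear (hu _ (hA w hw))
    refine ⟨_, lt_of_le_of_ne ?_ h1.symm, h2, h3, h4⟩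
    have h5 := h4 a₀ b₀
    have h6 := (hu _ (hA w hw)).2 z (interior_subset hz)
    rw [← hzc, inner_sub_left] at h5
    by_contra! hneg
    nlinarith [(h₁ w (hr₁' hw)).2]
  have hC : ∀ y ∈ frontier S ∩ ball x r, ∃ w ∈ ball (0 : Euc d) r, y = chartPt L x ν w (f w) := by
    rintro y ⟨hy, hyr⟩
    have h : y ∈ frontier S ∩ ball x ε := ⟨hy, hrε hyr⟩
    rw [hgraph] at h
    obtain ⟨⟨w, -, rfl⟩, -⟩ := h
    refine ⟨w, ?_, rfl⟩
    rw [mem_ball_zero_iff]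
    rw [mem_ball_iff_norm] at hyr
    exact (norm_le_norm_chartPt_sub hν hL w (f w)).trans_lt hyr
  refine ⟨hA, hB, hC, fun a b hab hfa => ?_⟩
  by_contra hnot
  obtain ⟨z', hz'r, hz'⟩ : ∃ z' ∈ ball x r, z' ∈ interior S := by
    have : x ∈ closure (interior S) := by
      rw [hconv.closure_interior_eq_closure_of_nonempty_interior ⟨z, hz⟩]
      exact subset_closure (hfront hx)
    have hrpos : 0 < r := by positivity
    exact mem_closure_iff.1 this _ isOpen_ball (mem_ball_self hrpos)
  set p := chartPt L x ν a b with hp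
  obtain ⟨q, hq, hqS⟩ : ((segment ℝ p z') ∩ frontier S).Nonempty := by
    by_contra hempty
    have hcover : segment ℝ p z' ⊆ interior S ∪ Sᶜ := by
      intro q hq
      by_contra hq'
      simp only [mem_union, mem_compl_iff, not_or, not_not] at hq'
      exact hempty ⟨q, hq, hclosed.frontier_eq ▸ ⟨hq'.2, hq'.1⟩⟩
    obtain ⟨q, -, hq1, hq2⟩ := (convex_segment p z').isPreconnected _ _ isOpen_interior
      hclosed.isOpen_compl hcover ⟨z', right_mem_segment ℝ p z', hz'⟩
      ⟨p, left_mem_segment ℝ p z', hnot⟩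
    exact hq2 (interior_subset hq1)
  have hqr : q ∈ ball x r := (convex_ball x r).segment_subset hab hz'r hq
  obtain ⟨w, hw, hqw⟩ := hC q ⟨hqS, hqr⟩
  have ha : a ∈ ball (0 : Euc d) r := by
    rw [mem_ball_zero_iff]
    rw [mem_ball_iff_norm] at hab
    exact (norm_le_norm_chartPt_sub hν hL a b).trans_lt hab
  obtain ⟨c, hc, -, -, hcB⟩ := hB w hw
  rw [← hqw] at hcB
  have hle : ∀ y ∈ S, ⟪y - q, u q⟫ ≤ 0 := fun y hy => by
    rw [inner_sub_left]; linarith [(hu q hqS).2 y hy]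
  have hp_le : ⟪p - q, u q⟫ ≤ 0 := by
    have h1 := hle _ (hfront (hA a ha))
    rw [hcB] at h1
    rw [hp, hcB]
    nlinarith
  have hz'_lt : ⟪z' - q, u q⟫ < 0 := by
    rw [inner_sub_left]
    linarith [inner_lt_of_mem_interior (hu q hqS) hz']
  obtain ⟨s, t, hs, ht, hst, hq⟩ := hq
  have hsum : s * ⟪p - q, u q⟫ + t * ⟪z' - q, u q⟫ = 0 := by
    simp only [inner_sub_left]
    have : ⟪q, u q⟫ = s * ⟪p, u q⟫ + t * ⟪z', u q⟫ := by
      rw [← real_inner_smul_left, ← real_inner_smul_left, ← inner_add_left, hq]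
    linear_combination (-⟪q, u q⟫) * hst - this
  have ht0 : t = 0 := by
    by_contra ht0
    have : 0 < t := lt_of_le_of_ne ht (Ne.symm ht0)
    nlinarith
  refine hnot ?_
  have : p = q := by
    rw [← hq, ht0, show s = 1 by linarith]
    simp
  rw [this]
  exact hfront hqS

end Chart

theorem exists_norm_le_mul_norm_map {d : ℕ} (R : Euc d →ₗ[ℝ] Euc d)
    (hR : LinearMap.det R ≠ 0) : ∃ C > 0, ∀ h, ‖h‖ ≤ C * ‖R h‖ := by
  have hker : LinearMap.ker R = ⊥ :=
    LinearMap.ker_eq_bot.2 (LinearMap.equivOfDetNeZero R hR).injective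
  obtain ⟨K, hK, hanti⟩ := R.exists_antilipschitzWith hker
  refine ⟨K, hK, fun h => ?_⟩
  simpa using hanti.le_mul_dist h 0

set_option maxHeartbeats 1000000 in
/-- Volume bounds for all small caps at boundary points near `x`. -/
theorem eventually_cap_volume_bounds {n d : ℕ} {L : Euc d →ₗᵢ[ℝ] Euc n} {x ν : Euc n}
    (hnd : n = d + 1) (hd : 1 ≤ d) (hν : ‖ν‖ = 1) (hL : ∀ v, ⟪L v, ν⟫ = 0)
    {S : Set (Euc n)} (hcomp : IsCompact S) (hconv : Convex ℝ S) (hint : (interior S).Nonempty)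
    {u : Euc n → Euc n} (hu : ∀ y ∈ frontier S, IsOuterNormalAt S y (u y))
    (hx : x ∈ frontier S) (hux : u x = ν)
    {f : Euc d → ℝ} {τ ε : ℝ} (hτ : 0 < τ) (hε : 0 < ε) (hf : ContDiffOn ℝ 2 f (ball 0 τ))
    (hf0 : f 0 = 0) (hf'0 : fderiv ℝ f 0 = 0)
    (hgraph : frontier S ∩ ball x ε
      = {y | ∃ v ∈ ball (0 : Euc d) τ, y = x + L v - f v • ν} ∩ ball x ε)
    {R : Euc d →ₗ[ℝ] Euc d} (hR : LinearMap.det R ≠ 0)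
    (hRf : ∀ h, ‖R h‖ ^ 2 = fderiv ℝ (fderiv ℝ f) 0 h h) {η : ℝ} (hη : 0 < η) (hη1 : η < 1) :
    ∀ᶠ p : Euc n × ℝ in 𝓝[frontier S] x ×ˢ 𝓝[>] (0 : ℝ),
      (1 + η) ^ (-((d : ℝ) / 2)) * p.2 ^ ((d : ℝ) / 2 + 1) *
          (2 ^ ((d : ℝ) / 2) / ((d : ℝ) / 2 + 1) *
            ((volume (ball (0 : Euc d) 1)).toReal / |LinearMap.det R|))
          ≤ (volume {ξ ∈ S | -p.2 ≤ ⟪ξ - p.1, u p.1⟫}).toReal ∧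
        (volume {ξ ∈ S | -p.2 ≤ ⟪ξ - p.1, u p.1⟫}).toReal ≤
          (1 - η) ^ (-((d : ℝ) / 2)) * ((1 + η) * p.2) ^ ((d : ℝ) / 2 + 1) *
          (2 ^ ((d : ℝ) / 2) / ((d : ℝ) / 2 + 1) *
            ((volume (ball (0 : Euc d) 1)).toReal / |LinearMap.det R|)) := by
  obtain ⟨r, hr, -, hA, hB, hC, hD⟩ := exists_graph_radius hnd hν hL hcomp.isClosed hconv hint
    hu hx hux hτ hε hf hf0 hf'0 hgraph
  obtain ⟨C, hC0, hCR⟩ := exists_norm_le_mul_norm_map R hR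
  have hf1 : ContDiffAt ℝ 2 f 0 := hf.contDiffAt (isOpen_ball.mem_nhds (mem_ball_self hτ))
  obtain ⟨ρ₁, hρ₁, hT⟩ := eventually_abs_taylor_le hf1 (c := η / (2 * C ^ 2)) (by positivity)
  have hf'c : ContinuousAt (fderiv ℝ f) 0 :=
    (hf1.fderiv_right (m := 1) (by norm_num)).continuousAt
  have hsmall : ∀ᶠ v in 𝓝 (0 : Euc d), ‖fderiv ℝ f v‖ < η :=
    hf'c.norm.eventually_lt continuousAt_const (by simpa [hf'0] using hη)
  obtain ⟨ρ₂, hρ₂, hN⟩ := Metric.eventually_nhds_iff_ball.1 hsmall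
  set ρ := min r (min ρ₁ ρ₂) with hρ
  have hρ0 : 0 < ρ := by positivity
  have hρr : ρ ≤ r := min_le_left _ _
  have hρ1 : ρ ≤ ρ₁ := (min_le_right _ _).trans (min_le_left _ _)
  have hρ2 : ρ ≤ ρ₂ := (min_le_right _ _).trans (min_le_right _ _)
  have hCR2 : ∀ h, ‖h‖ ^ 2 ≤ C ^ 2 * ‖R h‖ ^ 2 := fun h => by
    rw [← mul_pow]; gcongr; exact hCR h
  have htaylor : ∀ v ∈ ball (0 : Euc d) ρ, ∀ h, v + h ∈ ball (0 : Euc d) ρ →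
      |f (v + h) - f v - fderiv ℝ f v h - ‖R h‖ ^ 2 / 2| ≤ η / 2 * ‖R h‖ ^ 2 := by
    intro v hv h hvh
    have h1 := hT v (ball_subset_ball hρ1 hv) (v + h) (ball_subset_ball hρ1 hvh)
    rw [add_sub_cancel_left, ← hRf] at h1
    refine h1.trans ?_
    calc η / (2 * C ^ 2) * ‖h‖ ^ 2 ≤ η / (2 * C ^ 2) * (C ^ 2 * ‖R h‖ ^ 2) := by
          gcongr; exact hCR2 h
      _ = _ := by field_simp
  have hcore : ∀ v ∈ ball (0 : Euc d) ρ, ∀ h t, v + h ∈ ball (0 : Euc d) ρ →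
      chartPt L x ν (v + h) (f v + (fderiv ℝ f v h + t)) ∈ S → (1 - η) * ‖R h‖ ^ 2 ≤ 2 * t := by
    intro v hv h t hvh hS
    have hvr := ball_subset_ball hρr hvh
    obtain ⟨c, hc, -, -, hcB⟩ := hB _ hvr
    have h1 := hcB (v + h) (f v + (fderiv ℝ f v h + t))
    have h2 := (hu _ (hA _ hvr)).2 _ hS
    rw [inner_sub_left, sub_self, map_zero] at h1
    have h3 := (abs_le.1 (htaylor v hv h hvh)).1
    have h4 : f (v + h) ≤ f v + (fderiv ℝ f v h + t) := by
      by_contra! h5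
      nlinarith
    linarith
  have hev1 : ∀ᶠ y in 𝓝[frontier S] x, y ∈ frontier S ∩ ball x (ρ / 4) := by
    rw [inter_comm]
    exact inter_mem (mem_nhdsWithin_of_mem_nhds (ball_mem_nhds x (by positivity)))
      self_mem_nhdsWithin
  have hev2 : ∀ᶠ Δ in 𝓝[>] (0 : ℝ), 0 < Δ ∧ 2 * C ^ 2 * (1 + η) * Δ < (1 - η) * (ρ / 4) ^ 2 ∧
      2 * C ^ 2 * Δ < (ρ / 8) ^ 2 ∧ Δ < ρ / 8 := by
    have hlin : ∀ a b : ℝ, 0 < b → ∀ᶠ Δ in 𝓝[>] (0 : ℝ), a * Δ < b := by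
      intro a b hb
      have : ContinuousAt (fun Δ : ℝ => a * Δ) 0 := by fun_prop
      exact (this.eventually_lt continuousAt_const (by simpa using hb)).filter_mono
        nhdsWithin_le_nhds
    filter_upwards [self_mem_nhdsWithin,
      hlin (2 * C ^ 2 * (1 + η)) ((1 - η) * (ρ / 4) ^ 2) (mul_pos (by linarith) (by positivity)),
      hlin (2 * C ^ 2) ((ρ / 8) ^ 2) (by positivity), hlin 1 (ρ / 8) (by positivity)]
      with Δ h1 h2 h3 h4
    exact ⟨h1, h2, h3, by linarith⟩
  filter_upwards [hev1.prod_mk hev2]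
  rintro ⟨y, Δ⟩ ⟨⟨hyS, hyx⟩, hΔ, hΔ1, hΔ2, hΔ3⟩
  simp only at hyS hyx hΔ hΔ1 hΔ2 hΔ3 ⊢
  obtain ⟨v, hvr, hyv⟩ := hC y ⟨hyS, ball_subset_ball (by linarith) hyx⟩
  rw [mem_ball_iff_norm] at hyx
  have hv4 : ‖v‖ < ρ / 4 := by
    rw [hyv] at hyx
    exact (norm_le_norm_chartPt_sub hν hL v (f v)).trans_lt hyx
  have hvρ : v ∈ ball (0 : Euc d) ρ := by rw [mem_ball_zero_iff]; linarith
  obtain ⟨c, hc, hc1, hcη, hcB⟩ := hB v hvr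
  rw [← hyv] at hcB
  set l := fderiv ℝ f v with hl
  have hlη : ‖l‖ < η := hN v (ball_subset_ball hρ2 hvρ)
  have hc2 : 1 ≤ c * (1 + η) := by
    have h1 : c ^ 2 * (1 + ‖l‖ ^ 2) ≤ c ^ 2 * (1 + η) ^ 2 := by
      gcongr
      nlinarith [norm_nonneg l]
    have h2 : (1 : ℝ) ^ 2 ≤ (c * (1 + η)) ^ 2 := by rw [mul_pow]; linarith
    exact (pow_le_pow_iff_left₀ zero_le_one (by positivity) two_ne_zero).1 h2
  have hTpt : ∀ h t, y + (L h - (l h + t) • ν) = chartPt L x ν (v + h) (f v + (l h + t)) := by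
    intro h t
    rw [hyv]
    simp only [chartPt, map_add, add_smul]
    abel
  have hTin : ∀ h t, ⟪y + (L h - (l h + t) • ν) - y, u y⟫ = -(c * t) := by
    intro h t
    rw [hTpt, hcB]
    simp only [add_sub_cancel_left]
    ring
  have hyS' : y ∈ S := hcomp.isClosed.frontier_subset hyS
  set cap := {ξ ∈ S | -Δ ≤ ⟪ξ - y, u y⟫} with hcap
  have hcapm : MeasurableSet cap := by
    apply IsClosed.measurableSet
    have hcont : Continuous fun ξ => ⟪ξ - y, u y⟫ := by fun_prop
    exact hcomp.isClosed.inter (isClosed_le continuous_const hcont)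
  have hcapfin : volume cap ≠ ⊤ :=
    ((measure_mono (fun ξ hξ => hξ.1)).trans_lt hcomp.measure_lt_top).ne
  have hmp := measurePreserving_frame hnd L ν hν hL y l
  rw [← hmp.measure_preimage hcapm.nullMeasurableSet] at hcapfin ⊢
  set pre := (fun p : Euc d × ℝ => y + (L p.1 - (l p.1 + p.2) • ν)) ⁻¹' cap with hpre
  have hK : 0 ≤ 2 ^ ((d : ℝ) / 2) / ((d : ℝ) / 2 + 1) *
            ((volume (ball (0 : Euc d) 1)).toReal / |LinearMap.det R|) := by positivity
  have hlow : {p : Euc d × ℝ | (1 + η) * ‖R p.1‖ ^ 2 ≤ 2 * p.2 ∧ p.2 ≤ Δ} ⊆ pre := by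
    rintro ⟨h, t⟩ ⟨h1, h2⟩
    simp only at h1 h2
    have ht : 0 ≤ t := by
      have : 0 ≤ (1 + η) * ‖R h‖ ^ 2 := by positivity
      linarith
    have hh : ‖h‖ < ρ / 8 := by
      refine lt_of_pow_lt_pow_left₀ 2 (by positivity) ?_
      calc ‖h‖ ^ 2 ≤ C ^ 2 * ‖R h‖ ^ 2 := hCR2 h
        _ ≤ C ^ 2 * (2 * Δ) := by
          gcongr
          nlinarith [sq_nonneg ‖R h‖]
        _ < _ := by linarith
    have hlh : |l h| < ρ / 8 := by
      calc |l h| ≤ ‖l‖ * ‖h‖ := l.le_opNorm h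
        _ ≤ 1 * ‖h‖ := by gcongr; linarith
        _ < _ := by linarith
    refine ⟨?_, ?_⟩
    · simp only [hTpt]
      apply hD
      · rw [← hTpt, mem_ball_iff_norm]
        have e : y + (L h - (l h + t) • ν) - x = (y - x) + L h - (l h + t) • ν := by abel
        rw [e]
        have h3 : ‖(l h + t) • ν‖ ≤ |l h| + t := by
          rw [norm_smul, hν, mul_one, Real.norm_eq_abs]
          exact (abs_add_le _ _).trans_eq (by rw [abs_of_nonneg ht])
        have h4 := norm_sub_le ((y - x) + L h) ((l h + t) • ν)
        have h5 := norm_add_le (y - x) (L h)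
        rw [L.norm_map] at h5
        linarith
      · have hvh : v + h ∈ ball (0 : Euc d) ρ := by
          rw [mem_ball_zero_iff]
          linarith [norm_add_le v h]
        have h3 := (abs_le.1 (htaylor v hvρ h hvh)).2
        linarith
    · simp only [hTin]
      linarith [mul_le_of_le_one_left ht hc1]
  have hupp : pre ⊆ {p : Euc d × ℝ | (1 - η) * ‖R p.1‖ ^ 2 ≤ 2 * p.2 ∧ p.2 ≤ (1 + η) * Δ} := by
    rintro ⟨h, t⟩ ⟨h1, h2⟩
    simp only [hTin] at h2
    simp only at h1
    have h3 : c * t ≤ Δ := by linarith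
    have ht : 0 ≤ t := by
      have h4 := (hu y hyS).2 _ h1
      have h5 := hTin h t
      rw [inner_sub_left] at h5
      by_contra! h6
      nlinarith
    have htΔ : t ≤ (1 + η) * Δ := by
      calc t = 1 * t := (one_mul t).symm
        _ ≤ c * (1 + η) * t := by gcongr
        _ = (1 + η) * (c * t) := by ring
        _ ≤ _ := by gcongr
    have hscale : ∀ μ : ℝ, 0 ≤ μ → μ ≤ 1 → ‖μ • h‖ < 3 * ρ / 4 →
        (1 - η) * ‖R (μ • h)‖ ^ 2 ≤ 2 * (μ * t) := by
      intro μ hμ0 hμ1 hμh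
      apply hcore v hvρ
      · rw [mem_ball_zero_iff]
        linarith [norm_add_le v (μ • h)]
      · rw [← hl, ← hTpt]
        have h4 := hconv.add_smul_sub_mem hyS' h1 ⟨hμ0, hμ1⟩
        convert h4 using 2
        rw [add_sub_cancel_left, smul_sub, smul_smul, map_smul, map_smul, smul_eq_mul, mul_add]
    refine ⟨?_, htΔ⟩
    by_cases hh : ‖h‖ < 3 * ρ / 4
    · simpa using hscale 1 zero_le_one le_rfl (by simpa using hh)
    · exfalso
      push Not at hh
      have hh0 : 0 < ‖h‖ := by linarith
      have hμn : ‖(ρ / 4 / ‖h‖) • h‖ = ρ / 4 := by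
        rw [norm_smul, Real.norm_of_nonneg (by positivity)]
        field_simp
      have hμ1 : ρ / 4 / ‖h‖ ≤ 1 := by rw [div_le_one hh0]; linarith
      have h4 := hscale (ρ / 4 / ‖h‖) (by positivity) hμ1 (by rw [hμn]; linarith)
      have h5 := hCR2 ((ρ / 4 / ‖h‖) • h)
      rw [hμn] at h5
      have h6 : ρ / 4 / ‖h‖ * t ≤ (1 + η) * Δ := (mul_le_of_le_one_left ht hμ1).trans htΔ
      have h7 : (1 - η) * (ρ / 4) ^ 2 ≤
          C ^ 2 * ((1 - η) * ‖R ((ρ / 4 / ‖h‖) • h)‖ ^ 2) := by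
        calc (1 - η) * (ρ / 4) ^ 2 ≤ (1 - η) * (C ^ 2 * ‖R ((ρ / 4 / ‖h‖) • h)‖ ^ 2) := by
              gcongr
          _ = _ := by ring
      have h8 : C ^ 2 * ((1 - η) * ‖R ((ρ / 4 / ‖h‖) • h)‖ ^ 2) ≤
          C ^ 2 * (2 * ((1 + η) * Δ)) :=
        mul_le_mul_of_nonneg_left (by linarith) (by positivity)
      linarith
  constructor
  · have h1 := ENNReal.toReal_mono hcapfin (measure_mono hlow)
    rw [volume_paraboloid hd R hR (by linarith) hΔ.le, ENNReal.toReal_ofReal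
      (by positivity)] at h1
    exact h1
  · have h1 := measure_mono (μ := volume) hupp
    have h1η : 0 < 1 - η := by linarith
    rw [volume_paraboloid hd R hR h1η (by positivity)] at h1
    refine (ENNReal.toReal_mono ENNReal.ofReal_ne_top h1).trans_eq ?_
    rw [ENNReal.toReal_ofReal (by positivity)]

/-- A local minimum of a `C²` function has positive semidefinite Hessian. -/
theorem fderiv_fderiv_nonneg {d : ℕ} {f : Euc d → ℝ} (hf : ContDiffAt ℝ 2 f 0) (hf0 : f 0 = 0)
    (hf'0 : fderiv ℝ f 0 = 0) (hmin : ∀ᶠ w in 𝓝 0, 0 ≤ f w) (h : Euc d) :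
    0 ≤ fderiv ℝ (fderiv ℝ f) 0 h h := by
  by_contra! hneg
  set b := fderiv ℝ (fderiv ℝ f) 0 h h with hb
  have hc : 0 < -b / (4 * (‖h‖ ^ 2 + 1)) := div_pos (by linarith) (by positivity)
  obtain ⟨ρ, hρ, hT⟩ := eventually_abs_taylor_le hf hc
  have hcont : Tendsto (fun s : ℝ => s • h) (𝓝[>] 0) (𝓝 0) := by
    have : Continuous fun s : ℝ => s • h := by fun_prop
    have h := this.tendsto 0
    rw [zero_smul] at h
    exact h.mono_left nhdsWithin_le_nhds
  obtain ⟨s, ⟨hs1, hs2⟩, hs⟩ := (((hcont.eventually hmin).and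
    (hcont.eventually (ball_mem_nhds 0 hρ))).and self_mem_nhdsWithin).exists
  have hs0 : (0 : ℝ) < s := hs
  have h1 := (abs_le.1 (hT 0 (mem_ball_self hρ) _ hs2)).2
  simp only [hf0, hf'0, sub_zero, zero_apply, map_smul, smul_apply, smul_eq_mul, ← hb,
    norm_smul, Real.norm_eq_abs, mul_pow, sq_abs] at h1
  have h2 : -b / (4 * (‖h‖ ^ 2 + 1)) * (s ^ 2 * ‖h‖ ^ 2) ≤ s ^ 2 * (-b / 4) := by
    have h3 : ‖h‖ ^ 2 / (‖h‖ ^ 2 + 1) ≤ 1 := by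
      rw [div_le_one (by positivity)]; linarith
    calc -b / (4 * (‖h‖ ^ 2 + 1)) * (s ^ 2 * ‖h‖ ^ 2)
        = s ^ 2 * (-b / 4) * (‖h‖ ^ 2 / (‖h‖ ^ 2 + 1)) := by field_simp
      _ ≤ s ^ 2 * (-b / 4) := mul_le_of_le_one_right
        (mul_nonneg (by positivity) (by linarith)) h3
  nlinarith [mul_pos (sq_pos_of_pos hs0) (neg_pos.2 hneg)]

/-- The rescaled cap volume converges jointly as the boundary point tends to `x` and the height
tends to `0`. -/
theorem tendsto_cap_volume_div {n : ℕ} (hn : 2 ≤ n) {S : Set (Euc n)}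
    {u : Euc n → Euc n} {κ : Euc n → ℝ} (hS : IsSymConvexBody S) (hC2 : IsC2Body S u κ)
    {x : Euc n} (hx : x ∈ frontier S) (hκ : 0 < κ x) :
    Tendsto (fun p : Euc n × ℝ => (volume {ξ ∈ S | -p.2 ≤ ⟪ξ - p.1, u p.1⟫}).toReal /
        p.2 ^ (((n - 1 : ℕ) : ℝ) / 2 + 1))
      (𝓝[frontier S] x ×ˢ 𝓝[>] (0 : ℝ))
      (𝓝 (2 ^ (((n - 1 : ℕ) : ℝ) / 2) / (((n - 1 : ℕ) : ℝ) / 2 + 1) *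
        ((volume (ball (0 : Euc (n - 1)) 1)).toReal / (κ x) ^ ((1 : ℝ) / 2)))) := by
  obtain ⟨hcomp, hconv, hint, -⟩ := hS
  have hu : ∀ y ∈ frontier S, IsOuterNormalAt S y (u y) := fun y hy => (hC2 y hy).1
  obtain ⟨L, f, τ, ε, hτ, hε, hL, hf, hf0, hf'0, hgraph, hk⟩ := (hC2 x hx).2
  have hnd : n = (n - 1) + 1 := by omega
  have hν := (hu x hx).1
  have hf1 : ContDiffAt ℝ 2 f 0 := hf.contDiffAt (isOpen_ball.mem_nhds (mem_ball_self hτ))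
  obtain ⟨r, hr, -, hA, hB, -, -⟩ := exists_graph_radius hnd hν hL hcomp.isClosed hconv hint
    hu hx rfl hτ hε hf hf0 hf'0 hgraph
  have hmin : ∀ᶠ w in 𝓝 0, 0 ≤ f w := by
    filter_upwards [ball_mem_nhds 0 hr] with w hw
    obtain ⟨c, hc, -, -, hcB⟩ := hB 0 (mem_ball_self hr)
    have h1 := hcB w (f w)
    have h2 := (hu _ (hA 0 (mem_ball_self hr))).2 _ (hcomp.isClosed.frontier_subset (hA w hw))
    rw [inner_sub_left, hf'0, hf0] at h1
    rw [hf0] at h2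
    simp only [zero_apply, sub_zero, zero_sub] at h1
    by_contra! h3
    nlinarith
  have hsymm : ∀ y z, fderiv ℝ (fderiv ℝ f) 0 y z = fderiv ℝ (fderiv ℝ f) 0 z y :=
    hf1.isSymmSndFDerivAt (by simp)
  obtain ⟨R, hRf, hRdet⟩ := exists_linearMap_norm_sq_eq _ hsymm
    (fderiv_fderiv_nonneg hf1 hf0 hf'0 hmin)
  have hk' : κ x = (Matrix.of fun i j : Fin (n - 1) => fderiv ℝ (fderiv ℝ f) 0
      (EuclideanSpace.single i 1) (EuclideanSpace.single j 1)).det := by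
    rw [hk]
    simp only [iteratedFDeriv_two_apply, Matrix.cons_val_zero, Matrix.cons_val_one]
  rw [← hk', Real.sqrt_eq_rpow] at hRdet
  rw [← hRdet]
  have hR : LinearMap.det R ≠ 0 := by
    rw [← abs_pos, hRdet]; positivity
  set K := 2 ^ (((n - 1 : ℕ) : ℝ) / 2) / (((n - 1 : ℕ) : ℝ) / 2 + 1) *
        ((volume (ball (0 : Euc (n - 1)) 1)).toReal / |LinearMap.det R|)
  have hbounds : ∀ η : ℝ, 0 < η → η < 1 → _ := fun η h1 h2 =>
    eventually_cap_volume_bounds hnd (by omega) hν hL hcomp hconv hint hu hx rfl hτ hε hf hf0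
      hf'0 hgraph hR hRf (η := η) h1 h2
  have hpos : ∀ᶠ p : Euc n × ℝ in 𝓝[frontier S] x ×ˢ 𝓝[>] (0 : ℝ), 0 < p.2 :=
    tendsto_snd.eventually self_mem_nhdsWithin
  have hη1 : ∀ᶠ η : ℝ in 𝓝[>] 0, 0 < η ∧ η < 1 :=
    Ioo_mem_nhdsGT zero_lt_one
  refine tendsto_order.2 ⟨fun a ha => ?_, fun a ha => ?_⟩
  · have hlim : Tendsto (fun η : ℝ => (1 + η) ^ (-(((n - 1 : ℕ) : ℝ) / 2)) * K) (𝓝[>] 0) (𝓝 K) := by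
      have : ContinuousAt (fun η : ℝ => (1 + η) ^ (-(((n - 1 : ℕ) : ℝ) / 2)) * K) 0 :=
        ((by fun_prop : ContinuousAt (fun η : ℝ => 1 + η) 0).rpow_const
          (Or.inl (by norm_num))).mul continuousAt_const
      have h := this.tendsto.mono_left (nhdsWithin_le_nhds (s := Ioi 0))
      simpa using h
    obtain ⟨η, h1, h2, h3⟩ := ((hlim.eventually_const_lt ha).and hη1).exists
    filter_upwards [hbounds η h2 h3, hpos] with p hp hp0
    refine h1.trans_le ?_
    rw [le_div_iff₀ (by positivity)]
    linarith [hp.1]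
  · have hlim : Tendsto (fun η : ℝ =>
        (1 - η) ^ (-(((n - 1 : ℕ) : ℝ) / 2)) * (1 + η) ^ (((n - 1 : ℕ) : ℝ) / 2 + 1) * K)
        (𝓝[>] 0) (𝓝 K) := by
      have : ContinuousAt
          (fun η : ℝ =>
        (1 - η) ^ (-(((n - 1 : ℕ) : ℝ) / 2)) * (1 + η) ^ (((n - 1 : ℕ) : ℝ) / 2 + 1) * K) 0 :=
        (((by fun_prop : ContinuousAt (fun η : ℝ => 1 - η) 0).rpow_const
          (Or.inl (by norm_num))).mul
          ((by fun_prop : ContinuousAt (fun η : ℝ => 1 + η) 0).rpow_const (Or.inl (by norm_num)))).mul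
          continuousAt_const
      have h := this.tendsto.mono_left (nhdsWithin_le_nhds (s := Ioi 0))
      simpa using h
    obtain ⟨η, h1, h2, h3⟩ := ((hlim.eventually_lt_const ha).and hη1).exists
    filter_upwards [hbounds η h2 h3, hpos] with p hp hp0
    refine lt_of_le_of_lt ?_ h1
    rw [div_le_iff₀ (by positivity)]
    have h4 := hp.2
    rw [Real.mul_rpow (by linarith) hp0.le] at h4
    linarith

theorem continuousOn_of_tendsto_prod {X : Type*} [TopologicalSpace X] {s : Set X}
    {F : X × ℝ → ℝ} {K : X → ℝ}
    (h : ∀ x ∈ s, Tendsto F (𝓝[s] x ×ˢ 𝓝[>] (0 : ℝ)) (𝓝 (K x))) : ContinuousOn K s := by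
  intro x hx
  refine (closed_nhds_basis (K x)).tendsto_right_iff.2 fun C hC => ?_
  filter_upwards [((h x hx).eventually hC.1).curry, self_mem_nhdsWithin] with y hy hys
  have hpure : pure y ≤ 𝓝[s] y := pure_le_nhdsWithin hys
  have hy' : Tendsto (fun Δ => F (y, Δ)) (𝓝[>] 0) (𝓝 (K y)) :=
    (h y hys).comp ((tendsto_const_pure.mono_right hpure).prodMk tendsto_id)
  exact hC.2.mem_of_tendsto hy' hy

/-- On a compact set, a joint limit is attained with a uniform relative error. -/
theorem exists_uniform_relative_error {X : Type*} [TopologicalSpace X] {s : Set X}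
    (hs : IsCompact s) {F : X × ℝ → ℝ} {K : X → ℝ} (hK : ∀ x ∈ s, 0 < K x)
    (h : ∀ x ∈ s, Tendsto F (𝓝[s] x ×ˢ 𝓝[>] (0 : ℝ)) (𝓝 (K x))) :
    ∃ φ : ℝ → ℝ, (∀ Δ, 0 ≤ φ Δ) ∧ Tendsto φ (𝓝[>] 0) (𝓝 0) ∧
      ∃ Δ₀ > (0 : ℝ), ∀ x ∈ s, ∀ Δ : ℝ, 0 < Δ → Δ ≤ Δ₀ → |F (x, Δ) / K x - 1| ≤ φ Δ := by
  have hKc := continuousOn_of_tendsto_prod h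
  have hunif : TendstoUniformlyOn (fun Δ x => F (x, Δ) / K x) (fun _ => (1 : ℝ)) (𝓝[>] 0) s := by
    rw [← tendstoLocallyUniformlyOn_iff_tendstoUniformlyOn_of_compact hs,
      tendstoLocallyUniformlyOn_iff_forall_tendsto]
    intro x hx
    have h1 : Tendsto (fun p : X × ℝ => F p / K p.1) (𝓝[s] x ×ˢ 𝓝[>] (0 : ℝ)) (𝓝 1) := by
      have := (h x hx).div ((hKc x hx).tendsto.comp tendsto_fst) (hK x hx).ne'
      rwa [div_self (hK x hx).ne'] at this
    exact tendsto_left_nhds_uniformity.comp (h1.comp tendsto_prod_swap)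
  rw [Metric.tendstoUniformlyOn_iff] at hunif
  have hle : ∀ e > 0, ∀ᶠ Δ in 𝓝[>] (0 : ℝ), ∀ x : s, |F (x, Δ) / K x - 1| ≤ e := by
    intro e he
    filter_upwards [hunif e he] with Δ hΔ x
    have := hΔ x x.2
    rw [dist_comm, Real.dist_eq] at this
    exact this.le
  have hφ0 : ∀ Δ, 0 ≤ ⨆ x : s, |F (x, Δ) / K x - 1| := fun Δ =>
    Real.iSup_nonneg fun x => abs_nonneg _
  refine ⟨fun Δ => ⨆ x : s, |F (x, Δ) / K x - 1|, hφ0, ?_, ?_⟩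
  · refine tendsto_order.2 ⟨fun a ha => Eventually.of_forall fun Δ => ha.trans_le (hφ0 Δ),
      fun a ha => ?_⟩
    filter_upwards [hle (a / 2) (by linarith)] with Δ hΔ
    exact (Real.iSup_le hΔ (by linarith)).trans_lt (by linarith)
  · obtain ⟨Δ₁, hΔ₁, hsub⟩ := mem_nhdsGT_iff_exists_Ioc_subset.1 (hle 1 one_pos)
    refine ⟨Δ₁, hΔ₁, fun x hx Δ h1 h2 => ?_⟩
    exact le_ciSup (f := fun x : s => |F (x, Δ) / K x - 1|)
      ⟨1, by rintro _ ⟨y, rfl⟩; exact hsub ⟨h1, h2⟩ y⟩ ⟨x, hx⟩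


/-- Lemma 2.10 (1): for `S` of class `C²₊` there is a nonnegative function `φ` with `φ(Δ) → 0`
such that for every `x ∈ ∂S` and all small `Δ > 0`, the cap volume
`|{ξ ∈ S : ⟨ξ−x,u(x)⟩ ≥ −Δ}|ₙ` is `((2Δ)^{(n+1)/2}/(n+1))·|B₂^{n−1}|/κ(x)^{1/2}·(1 ± φ(Δ))`. -/
theorem statement14 {n : ℕ} (hn : 2 ≤ n) (S : Set (Euc n))
    (u : Euc n → Euc n) (κ : Euc n → ℝ)
    (hS : IsSymConvexBody S) (hC2 : IsC2Body S u κ)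
    (hκ : ∀ x ∈ frontier S, 0 < κ x) :
    ∃ φ : ℝ → ℝ, (∀ Δ, 0 ≤ φ Δ) ∧ Tendsto φ (𝓝[>] 0) (𝓝 0) ∧
      ∃ Δ₀ > (0:ℝ), ∀ x ∈ frontier S, ∀ Δ : ℝ, 0 < Δ → Δ ≤ Δ₀ →
        (2*Δ) ^ (((n:ℝ)+1)/2) / ((n:ℝ)+1) *
              ((volume (ball (0 : Euc (n-1)) 1)).toReal / (κ x) ^ ((1:ℝ)/2)) * (1 - φ Δ)
            ≤ (volume {ξ ∈ S | -Δ ≤ ⟪ξ - x, u x⟫}).toReal ∧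
          (volume {ξ ∈ S | -Δ ≤ ⟪ξ - x, u x⟫}).toReal
            ≤ (2*Δ) ^ (((n:ℝ)+1)/2) / ((n:ℝ)+1) *
              ((volume (ball (0 : Euc (n-1)) 1)).toReal / (κ x) ^ ((1:ℝ)/2)) * (1 + φ Δ) := by
  have hV : 0 < (volume (ball (0 : Euc (n - 1)) 1)).toReal :=
    ENNReal.toReal_pos (measure_ball_pos _ _ one_pos).ne' measure_ball_lt_top.ne
  have hpos : ∀ x ∈ frontier S, 0 < 2 ^ (((n - 1 : ℕ) : ℝ) / 2) / (((n - 1 : ℕ) : ℝ) / 2 + 1) *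
      ((volume (ball (0 : Euc (n - 1)) 1)).toReal / (κ x) ^ ((1 : ℝ) / 2)) := fun x hx => by
    have hκx := hκ x hx
    positivity
  obtain ⟨φ, hφ0, hφ, Δ₀, hΔ₀, hmain⟩ := exists_uniform_relative_error
    (hS.1.of_isClosed_subset isClosed_frontier hS.1.isClosed.frontier_subset) hpos
    (fun x hx => tendsto_cap_volume_div hn hS hC2 hx (hκ x hx))
  refine ⟨φ, hφ0, hφ, Δ₀, hΔ₀, fun x hx Δ hΔ hΔ' => ?_⟩
  have hκx := hκ x hx
  have hcast : ((n - 1 : ℕ) : ℝ) = n - 1 := by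
    rw [Nat.cast_sub (by omega), Nat.cast_one]
  have hcoef : (2 * Δ) ^ (((n : ℝ) + 1) / 2) / ((n : ℝ) + 1) *
      ((volume (ball (0 : Euc (n - 1)) 1)).toReal / (κ x) ^ ((1 : ℝ) / 2)) =
      Δ ^ (((n - 1 : ℕ) : ℝ) / 2 + 1) *
      (2 ^ (((n - 1 : ℕ) : ℝ) / 2) / (((n - 1 : ℕ) : ℝ) / 2 + 1) *
      ((volume (ball (0 : Euc (n - 1)) 1)).toReal / (κ x) ^ ((1 : ℝ) / 2))) := by
    have he : ((n : ℝ) + 1) / 2 = ((n - 1 : ℕ) : ℝ) / 2 + 1 := by rw [hcast]; ring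
    have hn1 : (n : ℝ) + 1 = 2 * (((n - 1 : ℕ) : ℝ) / 2 + 1) := by rw [hcast]; ring
    rw [he, hn1, Real.mul_rpow zero_le_two hΔ.le, Real.rpow_add_one two_ne_zero]
    field_simp
  have h1 := hmain x hx Δ hΔ hΔ'
  rw [hcoef]
  set K := 2 ^ (((n - 1 : ℕ) : ℝ) / 2) / (((n - 1 : ℕ) : ℝ) / 2 + 1) *
      ((volume (ball (0 : Euc (n - 1)) 1)).toReal / (κ x) ^ ((1 : ℝ) / 2))
  have hKpos : 0 < K := by positivity
  set D := Δ ^ (((n - 1 : ℕ) : ℝ) / 2 + 1)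
  have hDpos : 0 < D := by positivity
  rw [div_div, abs_le] at h1
  constructor
  · rw [mul_comm, ← le_div_iff₀ (by positivity)]
    linarith [h1.1]
  · rw [mul_comm, ← div_le_iff₀ (by positivity)]
    linarith [h1.2]
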